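/- arXiv:2511.00452 — 4 statements merged into one kernel-verified Lean document; each statement's English description precedes it below -/
import Mathlib

section
/- Let ‖·‖ be an arbitrary norm on ℝᵖ. Let X ⊆ ℝⁿ be a nonempty compact set, A a real p×n matrix, B a real p×m matrix, d ∈ ℝᵖ, and f : ℝⁿ → ℝ be upper semicontinuous on X. Define Z = { (x,y) ∈ X × ℝᵐ : ‖Ax + By + d‖ ≤ f(x) }. Assume (Assumption 1) for every x ∈ X there exists y ∈ ℝᵐ with ‖Ax + By + d‖ ≤ f(x), and (Assumption 2) every column of A and the vector d lie in the column space of B. Then conv(Z) = { (x,y) ∈ conv(X) × ℝᵐ : ‖Ax + By + d‖ ≤ f̂(x) }, where f̂ is the concave envelope of f over conv(X); moreover conv(Z) is a closed set. -/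
open Finset Matrix

/-- The concave envelope of `f` over `conv(X)`. -/
noncomputable def concaveEnvelope {n : ℕ} (X : Set (Fin n → ℝ)) (f : (Fin n → ℝ) → ℝ)
    (x : Fin n → ℝ) : ℝ :=
  sSup { s : ℝ | ∃ (lam : Fin (n + 1) → ℝ) (xs : Fin (n + 1) → Fin n → ℝ),
    (∀ k, 0 ≤ lam k) ∧ (∑ k, lam k = 1) ∧ (∀ k, xs k ∈ X) ∧
    (∑ k, lam k • xs k = x) ∧ s = ∑ k, lam k * f (xs k) }

open Module in
/-- A nonnegative combination of points of `E` can be rewritten with at most `finrank ℝ E + 1`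
points, without changing its total mass or value and without decreasing the combination of `φ`. -/
theorem exists_subset_card_le_finrank_succ_of_nonneg {ι E : Type*} [AddCommGroup E] [Module ℝ E]
    [FiniteDimensional ℝ E] (v : ι → E) (φ : ι → ℝ) (s : Finset ι) (w : ι → ℝ)
    (hw : ∀ i ∈ s, 0 ≤ w i) :
    ∃ t ⊆ s, t.card ≤ finrank ℝ E + 1 ∧ ∃ u : ι → ℝ, (∀ i ∈ t, 0 ≤ u i) ∧
      ∑ i ∈ t, u i = ∑ i ∈ s, w i ∧ ∑ i ∈ t, u i • v i = ∑ i ∈ s, w i • v i ∧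
      ∑ i ∈ s, w i * φ i ≤ ∑ i ∈ t, u i * φ i := by
  classical
  induction hN : s.card using Nat.strong_induction_on generalizing s w with
  | _ N ih =>
  subst hN
  by_cases hcard : s.card ≤ finrank ℝ E + 1
  · exact ⟨s, Subset.rfl, hcard, w, hw, rfl, rfl, le_rfl⟩
  have hdep : ¬ LinearIndependent ℝ (fun i : s => (v i, (1 : ℝ))) := fun h => by
    have := h.fintype_card_le_finrank
    simp at this
    omega
  obtain ⟨g₀, hg₀, ⟨j, hj⟩, hjne⟩ := Fintype.not_linearIndependent_iff.1 hdep
  obtain ⟨g, hgv, hg1, hgne, hgφ⟩ : ∃ g : ι → ℝ, ∑ i ∈ s, g i • v i = 0 ∧ ∑ i ∈ s, g i = 0 ∧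
      (∃ i ∈ s, g i ≠ 0) ∧ ∑ i ∈ s, g i * φ i ≤ 0 := by
    let g : ι → ℝ := fun i => if h : i ∈ s then g₀ ⟨i, h⟩ else 0
    have hg : ∀ i : s, g i = g₀ i := fun i => by simp [g]
    have h1 : ∑ i ∈ s, g i • v i = 0 := by
      rw [← Finset.sum_coe_sort]
      simpa [hg, Prod.fst_sum] using congrArg Prod.fst hg₀
    have h2 : ∑ i ∈ s, g i = 0 := by
      rw [← Finset.sum_coe_sort]
      simpa [hg, Prod.snd_sum] using congrArg Prod.snd hg₀
    have h3 : g j ≠ 0 := by rw [hg ⟨j, hj⟩]; exact hjne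
    rcases le_total (∑ i ∈ s, g i * φ i) 0 with h | h
    · exact ⟨g, h1, h2, ⟨j, hj, h3⟩, h⟩
    · exact ⟨-g, by simp [h1], by simp [h2], ⟨j, hj, by simpa using h3⟩, by simpa using h⟩
  have hpos : (s.filter (0 < g ·)).Nonempty := by
    obtain ⟨i, hi, h⟩ := Finset.exists_pos_of_sum_zero_of_exists_nonzero g hg1 hgne
    exact ⟨i, Finset.mem_filter.2 ⟨hi, h⟩⟩
  obtain ⟨k, hk, hmin⟩ := Finset.exists_min_image _ (fun i => w i / g i) hpos
  obtain ⟨hks, hgk⟩ := Finset.mem_filter.1 hk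
  have hθ : 0 ≤ w k / g k := div_nonneg (hw k hks) hgk.le
  let u : ι → ℝ := fun i => w i - w k / g k * g i
  have huk : u k = 0 := by simp [u, hgk.ne']
  have hu : ∀ i ∈ s, 0 ≤ u i := fun i hi => by
    rcases lt_or_ge 0 (g i) with h | h
    · exact sub_nonneg.2 ((le_div_iff₀ h).1 (hmin i (Finset.mem_filter.2 ⟨hi, h⟩)))
    · exact sub_nonneg.2 ((mul_nonpos_of_nonneg_of_nonpos hθ h).trans (hw i hi))
  obtain ⟨t, hts, htc, u', hu', h1, h2, h3⟩ := ih _ (Finset.card_erase_lt_of_mem hks)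
    (s.erase k) u (fun i hi => hu i (Finset.mem_of_mem_erase hi)) rfl
  refine ⟨t, hts.trans (Finset.erase_subset _ _), htc, u', hu', ?_, ?_, ?_⟩
  · rw [h1, Finset.sum_erase _ huk]
    simp [u, Finset.sum_sub_distrib, ← Finset.mul_sum, hg1]
  · rw [h2, Finset.sum_erase _ (by simp [huk])]
    simp [u, sub_smul, mul_smul, Finset.sum_sub_distrib, ← Finset.smul_sum, hgv]
  · refine le_trans ?_ h3
    rw [Finset.sum_erase _ (by simp [huk])]
    simp only [u, sub_mul, mul_assoc, Finset.sum_sub_distrib, ← Finset.mul_sum]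
    nlinarith

open Module in
/-- **Carathéodory's theorem** with exactly `finrank ℝ E + 1` possibly repeated points, whose
combination of the values of `φ` is no smaller than the given one. -/
theorem exists_fin_convexCombination_of_fintype {ι E : Type*} [Fintype ι] [AddCommGroup E]
    [Module ℝ E] [FiniteDimensional ℝ E] (v : ι → E) (φ : E → ℝ) (w : ι → ℝ)
    (hw : ∀ i, 0 ≤ w i) (hw1 : ∑ i, w i = 1) {N : ℕ} (hN : finrank ℝ E = N) :
    ∃ (lam : Fin (N + 1) → ℝ) (xs : Fin (N + 1) → E), (∀ k, 0 ≤ lam k) ∧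
      ∑ k, lam k = 1 ∧ (∀ k, xs k ∈ Set.range v) ∧ ∑ k, lam k • xs k = ∑ i, w i • v i ∧
      ∑ i, w i * φ (v i) ≤ ∑ k, lam k * φ (xs k) := by
  obtain ⟨t, -, htc, u, hu, h1, h2, h3⟩ := exists_subset_card_le_finrank_succ_of_nonneg v
    (φ ∘ v) Finset.univ w (fun i _ => hw i)
  have hι : Nonempty ι := by
    by_contra h
    rw [not_nonempty_iff] at h
    simp at hw1
  obtain ⟨i₀⟩ := hι
  obtain ⟨e⟩ : Nonempty (t ↪ Fin (N + 1)) :=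
    Function.Embedding.nonempty_of_card_le (by simpa [← hN] using htc)
  let lam : Fin (N + 1) → ℝ := Function.extend e (fun i => u i) 0
  let xs : Fin (N + 1) → E := Function.extend e (fun i => v i) fun _ => v i₀
  have hlam : ∀ i, lam (e i) = u i := e.injective.extend_apply _ _
  have hxs : ∀ i, xs (e i) = v i := e.injective.extend_apply _ _
  have hlam0 : ∀ k, k ∉ Set.range e → lam k = 0 := fun k hk => by
    simp only [lam]
    rw [Function.extend_apply' _ _ _ (by simpa using hk)]
    rfl
  refine ⟨lam, xs, fun k => ?_, ?_, fun k => ?_, ?_, ?_⟩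
  · by_cases hk : k ∈ Set.range e
    · obtain ⟨i, rfl⟩ := hk
      exact (hlam i).symm ▸ hu i i.2
    · exact (hlam0 k hk).ge
  · rw [← hw1, ← h1, ← Finset.sum_coe_sort t]
    exact (Fintype.sum_of_injective e e.injective _ _ hlam0 fun i => (hlam i).symm).symm
  · by_cases hk : k ∈ Set.range e
    · obtain ⟨i, rfl⟩ := hk
      exact ⟨i, (hxs i).symm⟩
    · simp only [xs]
      rw [Function.extend_apply' _ _ _ (by simpa using hk)]
      exact ⟨i₀, rfl⟩
  · rw [← h2, ← Finset.sum_coe_sort t]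
    exact (Fintype.sum_of_injective e e.injective _ _ (fun k hk => by simp [hlam0 k hk])
      fun i => by rw [hlam, hxs]).symm
  · refine h3.trans_eq ?_
    rw [← Finset.sum_coe_sort t]
    exact Fintype.sum_of_injective e e.injective _ _ (fun k hk => by simp [hlam0 k hk])
      fun i => by rw [hlam, hxs, Function.comp_apply]

/-- The convex hull of a compact set in a finite-dimensional space is compact. -/
theorem IsCompact.isCompact_convexHull_of_finiteDimensional {E : Type*} [NormedAddCommGroup E]
    [NormedSpace ℝ E] [FiniteDimensional ℝ E] {s : Set E} (hs : IsCompact s) :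
    IsCompact (convexHull ℝ s) := by
  have hK := ((isCompact_stdSimplex ℝ (Fin (Module.finrank ℝ E + 1))).prod
    (isCompact_univ_pi fun _ : Fin (Module.finrank ℝ E + 1) => hs)).image
    (f := fun q => ∑ k, q.1 k • q.2 k) (by fun_prop)
  convert hK using 1
  ext x
  constructor
  · rw [mem_convexHull_iff_exists_fintype]
    rintro ⟨ι, _, w, z, hw, hw1, hz, rfl⟩
    obtain ⟨lam, xs, h0, h1, hr, hx, -⟩ :=
      exists_fin_convexCombination_of_fintype z 0 w hw hw1 rfl
    refine ⟨(lam, xs), ⟨⟨h0, h1⟩, fun k _ => Set.range_subset_iff.2 hz (hr k)⟩, hx⟩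
  · rintro ⟨⟨lam, xs⟩, ⟨⟨h0, h1⟩, hxs⟩, rfl⟩
    exact mem_convexHull_of_exists_fintype lam xs h0 h1 (fun k => hxs k trivial) rfl

/-- The part of the hypograph of `f` over `X` lying above height zero. -/
def nonnegHypograph {E : Type*} (X : Set E) (f : E → ℝ) : Set (E × ℝ) :=
  {p | p.1 ∈ X ∧ 0 ≤ p.2 ∧ p.2 ≤ f p.1}

theorem isCompact_nonnegHypograph {E : Type*} [TopologicalSpace E] [T2Space E] {X : Set E}
    (hX : IsCompact X) {f : E → ℝ} (hf : UpperSemicontinuousOn f X) :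
    IsCompact (nonnegHypograph X f) := by
  obtain ⟨M, hM⟩ := hf.bddAbove_of_isCompact hX
  refine (hX.prod (isCompact_Icc (a := 0) (b := M))).of_isClosed_subset ?_ ?_
  · have h1 := (upperSemicontinuousOn_iff_isClosed_hypograph hX.isClosed).1 hf
    have h2 : IsClosed {p : E × ℝ | 0 ≤ p.2} := isClosed_le continuous_const continuous_snd
    convert h1.inter h2 using 1
    ext p
    simp only [nonnegHypograph, Set.mem_ofPred_eq, Set.mem_inter_iff]
    tauto
  · exact fun p hp => ⟨hp.1, hp.2.1, hp.2.2.trans (hM ⟨_, hp.1, rfl⟩)⟩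

theorem convexHull_nonnegHypograph_snd_nonneg {E : Type*} [AddCommGroup E] [Module ℝ E]
    {X : Set E} {f : E → ℝ} {p : E × ℝ} (hp : p ∈ convexHull ℝ (nonnegHypograph X f)) :
    0 ≤ p.2 :=
  convexHull_min (t := {p : E × ℝ | 0 ≤ p.2}) (fun _ hq => hq.2.1)
    (convex_halfSpace_ge (LinearMap.snd ℝ E ℝ).isLinear 0) hp

/-- Some level `t ≥ r` over `x` lies in the convex hull of the hypograph exactly when
`x ∈ conv X` and the concave envelope at `x` is at least `r`. -/
theorem exists_mem_convexHull_nonnegHypograph_iff {n : ℕ} {X : Set (Fin n → ℝ)}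
    (hX : IsCompact X) {f : (Fin n → ℝ) → ℝ} (hf : UpperSemicontinuousOn f X)
    (hf0 : ∀ x ∈ X, 0 ≤ f x) (x : Fin n → ℝ) (r : ℝ) :
    (∃ t, (x, t) ∈ convexHull ℝ (nonnegHypograph X f) ∧ r ≤ t) ↔
      x ∈ convexHull ℝ X ∧ r ≤ concaveEnvelope X f x := by
  set S := { s : ℝ | ∃ (lam : Fin (n + 1) → ℝ) (xs : Fin (n + 1) → Fin n → ℝ),
    (∀ k, 0 ≤ lam k) ∧ (∑ k, lam k = 1) ∧ (∀ k, xs k ∈ X) ∧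
    (∑ k, lam k • xs k = x) ∧ s = ∑ k, lam k * f (xs k) }
  have hK := (isCompact_nonnegHypograph hX hf).isCompact_convexHull_of_finiteDimensional
  have hSK : ∀ s ∈ S, (x, s) ∈ convexHull ℝ (nonnegHypograph X f) := by
    rintro s ⟨lam, xs, h0, h1, hxs, rfl, rfl⟩
    refine mem_convexHull_of_exists_fintype lam (fun k => (xs k, f (xs k))) h0 h1
      (fun k => ⟨hxs k, hf0 _ (hxs k), le_rfl⟩) ?_
    ext <;> simp [Prod.fst_sum, Prod.snd_sum]
  have hbdd : BddAbove S := by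
    obtain ⟨M, hM⟩ := (hK.image continuous_snd).bddAbove
    exact ⟨M, fun s hs => hM ⟨_, hSK s hs, rfl⟩⟩
  have hge : ∀ {ι : Type} [Fintype ι] (w : ι → ℝ) (z : ι → Fin n → ℝ), (∀ i, 0 ≤ w i) →
      ∑ i, w i = 1 → (∀ i, z i ∈ X) → ∑ i, w i • z i = x →
      ∃ s ∈ S, ∑ i, w i * f (z i) ≤ s := by
    intro ι _ w z hw hw1 hz hx
    obtain ⟨lam, xs, h0, h1, hr, hx', hle⟩ :=
      exists_fin_convexCombination_of_fintype z f w hw hw1 (N := n) (by simp)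
    exact ⟨_, ⟨lam, xs, h0, h1, fun k => Set.range_subset_iff.2 hz (hr k), hx'.trans hx, rfl⟩, hle⟩
  constructor
  · rintro ⟨t, ht, hrt⟩
    rw [mem_convexHull_iff_exists_fintype] at ht
    obtain ⟨ι, _, w, z, hw, hw1, hz, hxt⟩ := ht
    have hx : ∑ i, w i • (z i).1 = x := by
      simpa [Prod.fst_sum] using congrArg Prod.fst hxt
    have ht : ∑ i, w i * (z i).2 = t := by
      simpa [Prod.snd_sum] using congrArg Prod.snd hxt
    obtain ⟨s, hs, hle⟩ := hge w (fun i => (z i).1) hw hw1 (fun i => (hz i).1) hx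
    refine ⟨mem_convexHull_of_exists_fintype w _ hw hw1 (fun i => (hz i).1) hx, ?_⟩
    calc r ≤ t := hrt
      _ = ∑ i, w i * (z i).2 := ht.symm
      _ ≤ ∑ i, w i * f (z i).1 :=
        Finset.sum_le_sum fun i _ => mul_le_mul_of_nonneg_left (hz i).2.2 (hw i)
      _ ≤ s := hle
      _ ≤ sSup S := le_csSup hbdd hs
  · rintro ⟨hx, hr⟩
    refine ⟨concaveEnvelope X f x, ?_, hr⟩
    have hne : S.Nonempty := by
      rw [mem_convexHull_iff_exists_fintype] at hx
      obtain ⟨ι, _, w, z, hw, hw1, hz, hx⟩ := hx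
      obtain ⟨s, hs, -⟩ := hge w z hw hw1 hz hx
      exact ⟨s, hs⟩
    have hcl : IsClosed {t : ℝ | (x, t) ∈ convexHull ℝ (nonnegHypograph X f)} :=
      hK.isClosed.preimage (by fun_prop)
    exact hcl.closure_subset_iff.2 hSK (csSup_mem_closure hne hbdd)

section SeminormSublevel

variable {E F : Type*} [AddCommGroup E] [Module ℝ E] [AddCommGroup F] [Module ℝ F]
  (N : Seminorm ℝ F) (L : E →ₗ[ℝ] F) (c : F) {X : Set E} {f : E → ℝ}

/-- A point bounded by a convex combination `a * t + b * s` of nonnegative levels is the same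
combination of points bounded by `t` and `s`. -/
theorem Seminorm.exists_convexCombination_le {a b t s : ℝ} (hab : a + b = 1)
    (ht : 0 ≤ t) (hs : 0 ≤ s) {u : F} (hu : N u ≤ a * t + b * s) :
    ∃ v w : F, a • v + b • w = u ∧ N v ≤ t ∧ N w ≤ s := by
  rcases ((apply_nonneg N u).trans hu).eq_or_lt with h0 | hpos
  · have hu0 : N u ≤ 0 := hu.trans_eq h0.symm
    exact ⟨u, u, by rw [← add_smul, hab, one_smul], hu0.trans ht, hu0.trans hs⟩
  · have key : ∀ r : ℝ, 0 ≤ r → N ((r / (a * t + b * s)) • u) ≤ r := fun r hr => by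
      rw [map_smul_eq_mul, Real.norm_of_nonneg (by positivity), div_mul_eq_mul_div,
        div_le_iff₀ hpos]
      exact mul_le_mul_of_nonneg_left hu hr
    refine ⟨_, _, ?_, key t ht, key s hs⟩
    rw [smul_smul, smul_smul, ← add_smul, ← mul_div_assoc, ← mul_div_assoc, ← add_div,
      div_self hpos.ne', one_smul]

/-- The convex hull of a family of seminorm balls with radii `f` is described by the convex hull of
the hypograph of `f`. -/
theorem convexHull_seminorm_le_eq :
    convexHull ℝ {q : E × F | q.1 ∈ X ∧ N (L q.1 + q.2 + c) ≤ f q.1} =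
      {q : E × F | ∃ t, (q.1, t) ∈ convexHull ℝ (nonnegHypograph X f) ∧
        N (L q.1 + q.2 + c) ≤ t} := by
  apply Set.Subset.antisymm
  · refine convexHull_min ?_ ?_
    · exact fun q hq => ⟨f q.1, subset_convexHull ℝ _
        ⟨hq.1, (apply_nonneg N _).trans hq.2, le_rfl⟩, hq.2⟩
    · rintro ⟨x, y⟩ ⟨t, hxt, hle⟩ ⟨x', y'⟩ ⟨t', hxt', hle'⟩ a b ha hb hab
      refine ⟨a * t + b * t', convex_convexHull ℝ _ hxt hxt' ha hb hab, ?_⟩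
      have h : L (a • x + b • x') + (a • y + b • y') + c
          = a • (L x + y + c) + b • (L x' + y' + c) := by
        have hc : c = a • c + b • c := by rw [← add_smul, hab, one_smul]
        nth_rewrite 1 [hc]
        simp only [map_add, map_smul, smul_add]
        abel
      calc N (L (a • x + b • x') + (a • y + b • y') + c)
          ≤ N (a • (L x + y + c)) + N (b • (L x' + y' + c)) := h ▸ map_add_le_add N _ _
        _ = a * N (L x + y + c) + b * N (L x' + y' + c) := by
          rw [map_smul_eq_mul, map_smul_eq_mul, Real.norm_of_nonneg ha, Real.norm_of_nonneg hb]
        _ ≤ a * t + b * t' := by gcongr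
  · rintro ⟨x, y⟩ ⟨t, hxt, hle⟩
    suffices h : convexHull ℝ (nonnegHypograph X f) ⊆ {p | p ∈ convexHull ℝ (nonnegHypograph X f) ∧
        ∀ y, N (L p.1 + y + c) ≤ p.2 → (p.1, y) ∈
          convexHull ℝ {q : E × F | q.1 ∈ X ∧ N (L q.1 + q.2 + c) ≤ f q.1}} from
      (h hxt).2 y hle
    refine convexHull_min
      (fun p hp => ⟨subset_convexHull ℝ _ hp, fun y hy => subset_convexHull ℝ _
        ⟨hp.1, hy.trans hp.2.2⟩⟩) ?_
    rintro ⟨x, t⟩ ⟨hp, hx⟩ ⟨x', t'⟩ ⟨hp', hx'⟩ a b ha hb hab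
    refine ⟨convex_convexHull ℝ _ hp hp' ha hb hab, fun y hy => ?_⟩
    obtain ⟨v, w, hvw, hv, hw⟩ := N.exists_convexCombination_le hab
      (convexHull_nonnegHypograph_snd_nonneg hp) (convexHull_nonnegHypograph_snd_nonneg hp') hy
    have h1 := hx (v - L x - c) (by simpa [add_assoc] using hv)
    have h2 := hx' (w - L x' - c) (by simpa [add_assoc] using hw)
    convert! convex_convexHull ℝ _ h1 h2 ha hb hab using 1
    refine Prod.ext rfl ?_
    have hc : c = a • c + b • c := by rw [← add_smul, hab, one_smul]
    have hy' : y = (a • v + b • w) - L (a • x + b • x') - c := by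
      rw [hvw]
      change y = L (a • x + b • x') + y + c - L (a • x + b • x') - c
      abel
    change y = a • (v - L x - c) + b • (w - L x' - c)
    rw [hy']
    nth_rewrite 1 [hc]
    simp only [map_add, map_smul, smul_sub]
    abel

end SeminormSublevel

/-- Projecting out a real level that ranges over a compact set preserves closedness. -/
theorem isClosed_setOf_exists_mem_and_le {α E : Type*} [TopologicalSpace α] [TopologicalSpace E]
    [T2Space E] {K : Set (E × ℝ)} (hK : IsCompact K) {π : α → E} (hπ : Continuous π)
    {g : α → ℝ} (hg : Continuous g) :
    IsClosed {q : α | ∃ t, (π q, t) ∈ K ∧ g q ≤ t} := by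
  have hI := hK.image continuous_snd
  have : CompactSpace (Prod.snd '' K) := isCompact_iff_compactSpace.1 hI
  have hC : IsClosed {p : α × (Prod.snd '' K) | (π p.1, (p.2 : ℝ)) ∈ K ∧ g p.1 ≤ p.2} :=
    (hK.isClosed.preimage (f := fun p : α × (Prod.snd '' K) => (π p.1, (p.2 : ℝ)))
      (by fun_prop)).inter
      (isClosed_le (hg.comp continuous_fst) (continuous_subtype_val.comp continuous_snd))
  convert isClosedMap_fst_of_compactSpace _ hC using 1
  ext q
  constructor
  · rintro ⟨t, h1, h2⟩
    exact ⟨(q, ⟨t, _, h1, rfl⟩), ⟨h1, h2⟩, rfl⟩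
  · rintro ⟨⟨q, t⟩, ⟨h1, h2⟩, rfl⟩
    exact ⟨t, h1, h2⟩

theorem Seminorm.continuous_of_finiteDimensional {E : Type*} [NormedAddCommGroup E]
    [NormedSpace ℝ E] [FiniteDimensional ℝ E] (N : Seminorm ℝ E) : Continuous N := by
  rw [← continuousOn_univ]
  exact N.convexOn.continuousOn isOpen_univ

theorem convexHull_eq_of_concaveEnvelope_general_norm
    {n m p : ℕ} (nrm : (Fin p → ℝ) → ℝ)
    -- `nrm` is an arbitrary norm on ℝᵖ
    (hnrm0 : ∀ v, nrm v = 0 ↔ v = 0)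
    (hnrm_smul : ∀ (a : ℝ) (v : Fin p → ℝ), nrm (a • v) = |a| * nrm v)
    (hnrm_add : ∀ v w : Fin p → ℝ, nrm (v + w) ≤ nrm v + nrm w)
    (X : Set (Fin n → ℝ)) (hXne : X.Nonempty) (hX : IsCompact X)
    (A : Matrix (Fin p) (Fin n) ℝ) (B : Matrix (Fin p) (Fin m) ℝ) (d : Fin p → ℝ)
    (f : (Fin n → ℝ) → ℝ) (hf : UpperSemicontinuousOn f X)
    -- Assumption 1: for every x ∈ X there is y with ‖Ax + By + d‖ ≤ f(x)
    (hA1 : ∀ x ∈ X, ∃ y : Fin m → ℝ, nrm (A.mulVec x + B.mulVec y + d) ≤ f x)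
    -- Assumption 2: columns of A and the vector d lie in the column space of B
    (hA2col : ∀ j : Fin n, (fun i => A i j) ∈ LinearMap.range B.mulVecLin)
    (hA2d : d ∈ LinearMap.range B.mulVecLin) :
    convexHull ℝ {q : (Fin n → ℝ) × (Fin m → ℝ) | q.1 ∈ X ∧
        nrm (A.mulVec q.1 + B.mulVec q.2 + d) ≤ f q.1}
      = {q : (Fin n → ℝ) × (Fin m → ℝ) | q.1 ∈ convexHull ℝ X ∧
        nrm (A.mulVec q.1 + B.mulVec q.2 + d) ≤ concaveEnvelope X f q.1} ∧
    IsClosed (convexHull ℝ {q : (Fin n → ℝ) × (Fin m → ℝ) | q.1 ∈ X ∧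
        nrm (A.mulVec q.1 + B.mulVec q.2 + d) ≤ f q.1}) := by
  choose C hC using hA2col
  obtain ⟨c, hc⟩ := hA2d
  let nrmS : Seminorm ℝ (Fin p → ℝ) := Seminorm.of nrm hnrm_add hnrm_smul
  let N : Seminorm ℝ (Fin m → ℝ) := nrmS.comp B.mulVecLin
  let L : (Fin n → ℝ) →ₗ[ℝ] (Fin m → ℝ) := (Matrix.of C)ᵀ.mulVecLin
  have hBL : ∀ x, B.mulVec (L x) = A.mulVec x := fun x => by
    have hA : B * (Matrix.of C)ᵀ = A := by
      ext i j
      exact congrFun (hC j) i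
    simp only [L, Matrix.mulVecLin_apply, Matrix.mulVec_mulVec, hA]
  have hN : ∀ (x : Fin n → ℝ) (y : Fin m → ℝ),
      nrm (A.mulVec x + B.mulVec y + d) = N (L x + y + c) := fun x y => by
    change _ = nrm (B.mulVec (L x + y + c))
    rw [Matrix.mulVec_add, Matrix.mulVec_add, hBL, ← hc, Matrix.mulVecLin_apply]
  have hf0 : ∀ x ∈ X, 0 ≤ f x := fun x hx => by
    obtain ⟨y, hy⟩ := hA1 x hx
    exact (apply_nonneg nrmS _).trans hy
  simp only [hN, convexHull_seminorm_le_eq]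
  refine ⟨Set.ext fun q => exists_mem_convexHull_nonnegHypograph_iff hX hf hf0 q.1 _, ?_⟩
  refine isClosed_setOf_exists_mem_and_le
    (isCompact_nonnegHypograph hX hf).isCompact_convexHull_of_finiteDimensional
    continuous_fst (N.continuous_of_finiteDimensional.comp ?_)
  have := L.continuous_of_finiteDimensional
  fun_prop
end

section
/- Let X ⊆ ℝⁿ be a nonempty compact set, A a real p×n matrix, B a real p×m matrix with linearly independent columns (i.e., the linear map y ↦ By is injective), d ∈ ℝᵖ, and f : ℝⁿ → ℝ be upper semicontinuous on X. Define Z = { (x,y) ∈ X × ℝᵐ : ‖Ax + By + d‖₂ ≤ f(x) } and W = { (x,y) ∈ conv(X) × ℝᵐ : ‖Ax + By + d‖₂ ≤ f̂(x) }, where f̂ is the concave envelope of f over conv(X). Assume (Assumption 1) for every x ∈ X there exists y ∈ ℝᵐ with ‖Ax + By + d‖₂ ≤ f(x), and (Assumption 2) every column of A and the vector d lie in the column space of B. Then every extreme point of W belongs to Z. -/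
open Finset Matrix

/-- The Euclidean norm on `ℝᵖ`. -/
noncomputable def euclNorm {p : ℕ} (v : Fin p → ℝ) : ℝ := Real.sqrt (∑ i, v i ^ 2)

theorem euclNorm_eq_norm {p : ℕ} (v : Fin p → ℝ) : euclNorm v = ‖WithLp.toLp 2 v‖ := by
  simp [euclNorm, EuclideanSpace.norm_eq]

theorem euclNorm_nonneg {p : ℕ} (v : Fin p → ℝ) : 0 ≤ euclNorm v := Real.sqrt_nonneg _

theorem euclNorm_smul {p : ℕ} {c : ℝ} (hc : 0 ≤ c) (v : Fin p → ℝ) :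
    euclNorm (c • v) = c * euclNorm v := by
  simp [euclNorm_eq_norm, norm_smul, abs_of_nonneg hc]

theorem eq_zero_of_euclNorm_nonpos {p : ℕ} {v : Fin p → ℝ} (hv : euclNorm v ≤ 0) : v = 0 := by
  rw [euclNorm_eq_norm, norm_le_zero_iff] at hv
  simpa using hv

theorem euclNorm_sum_smul_le {p : ℕ} {ι : Type*} [Fintype ι] {w : ι → ℝ} (hw : ∀ i, 0 ≤ w i)
    (v : ι → Fin p → ℝ) : euclNorm (∑ i, w i • v i) ≤ ∑ i, w i * euclNorm (v i) := by
  calc euclNorm (∑ i, w i • v i) ≤ ∑ i, euclNorm (w i • v i) := by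
        simpa only [euclNorm_eq_norm, WithLp.toLp_sum] using norm_sum_le _ _
    _ = ∑ i, w i * euclNorm (v i) :=
        Finset.sum_congr rfl fun i _ => euclNorm_smul (hw i) (v i)

/-- A product of nonnegative functions, one continuous and the other upper semicontinuous, is
upper semicontinuous. -/
theorem ContinuousOn.mul_upperSemicontinuousOn {α : Type*} [TopologicalSpace α] {s : Set α}
    {g h : α → ℝ} (hg : ContinuousOn g s) (hh : UpperSemicontinuousOn h s)
    (hg₀ : ∀ x ∈ s, 0 ≤ g x) : UpperSemicontinuousOn (fun x => g x * h x) s := by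
  intro x hx c hc
  obtain ⟨b, hhb, hbc⟩ : ∃ b, h x < b ∧ g x * b < c := by
    have hlim : Filter.Tendsto (fun b => g x * b) (nhdsWithin (h x) (Set.Ioi (h x)))
        (nhds (g x * h x)) :=
      ((continuous_const_mul (g x)).tendsto (h x)).mono_left nhdsWithin_le_nhds
    exact ((eventually_mem_nhdsWithin).and (hlim.eventually_lt_const hc)).exists
  have hgb : ∀ᶠ z in nhdsWithin x s, g z * b < c :=
    ((hg x hx).mul_const b).eventually_lt_const hbc
  filter_upwards [hh x hx b hhb, hgb, self_mem_nhdsWithin] with z hz hzc hzs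
  exact (mul_le_mul_of_nonneg_left hz.le (hg₀ z hzs)).trans_lt hzc

theorem exists_fin_convexCombination_of_mem_convexHull {n : ℕ} {X : Set (Fin n → ℝ)}
    {x : Fin n → ℝ} (hx : x ∈ convexHull ℝ X) :
    ∃ (lam : Fin (n + 1) → ℝ) (xs : Fin (n + 1) → Fin n → ℝ),
      (∀ k, 0 ≤ lam k) ∧ (∑ k, lam k = 1) ∧ (∀ k, xs k ∈ X) ∧ ∑ k, lam k • xs k = x := by
  obtain ⟨x₀, hx₀⟩ := convexHull_nonempty_iff.1 ⟨x, hx⟩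
  obtain ⟨ι, _, z, w, hz, hind, hw, hw₁, rfl⟩ := eq_pos_convex_span_of_mem_convexHull hx
  have hcard : Fintype.card ι ≤ Fintype.card (Fin (n + 1)) := by
    have h := hind.card_le_finrank_succ
    have h' := Submodule.finrank_le (vectorSpan ℝ (Set.range z))
    simp only [Module.finrank_fin_fun, Fintype.card_fin] at h' ⊢
    lia
  obtain ⟨e⟩ := Function.Embedding.nonempty_of_card_le hcard
  refine ⟨Function.extend e w 0, Function.extend e z fun _ => x₀, fun k => ?_, ?_, fun k => ?_, ?_⟩
  · by_cases hk : ∃ i, e i = k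
    · obtain ⟨i, rfl⟩ := hk
      simpa [e.injective.extend_apply] using (hw i).le
    · simp [Function.extend_apply' _ _ _ hk]
  · rw [← hw₁]
    refine (Fintype.sum_of_injective e e.injective _ _ (fun k hk => ?_) fun i => ?_).symm
    · exact Function.extend_apply' _ _ _ hk
    · rw [e.injective.extend_apply]
  · by_cases hk : ∃ i, e i = k
    · obtain ⟨i, rfl⟩ := hk
      rw [e.injective.extend_apply]
      exact hz ⟨i, rfl⟩
    · rwa [Function.extend_apply' _ _ _ hk]
  · refine (Fintype.sum_of_injective e e.injective _ _ (fun k hk => ?_) fun i => ?_).symm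
    · simp [Function.extend_apply' w _ _ hk]
    · rw [e.injective.extend_apply, e.injective.extend_apply]

/-- The supremum defining the concave envelope is attained. -/
theorem isGreatest_concaveEnvelope {n : ℕ} {X : Set (Fin n → ℝ)} (hX : IsCompact X)
    {f : (Fin n → ℝ) → ℝ} (hf : UpperSemicontinuousOn f X)
    {x : Fin n → ℝ} (hx : x ∈ convexHull ℝ X) :
    IsGreatest { s : ℝ | ∃ (lam : Fin (n + 1) → ℝ) (xs : Fin (n + 1) → Fin n → ℝ),
      (∀ k, 0 ≤ lam k) ∧ (∑ k, lam k = 1) ∧ (∀ k, xs k ∈ X) ∧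
      (∑ k, lam k • xs k = x) ∧ s = ∑ k, lam k * f (xs k) } (concaveEnvelope X f x) := by
  let K : Set ((Fin (n + 1) → ℝ) × (Fin (n + 1) → Fin n → ℝ)) :=
    (stdSimplex ℝ (Fin (n + 1)) ×ˢ Set.univ.pi fun _ => X) ∩ {q | ∑ k, q.1 k • q.2 k = x}
  have hK : IsCompact K :=
    ((isCompact_stdSimplex ℝ _).prod (isCompact_univ_pi fun _ => hX)).inter_right
      (isClosed_eq (by fun_prop) continuous_const)
  have hKX : ∀ k, Set.MapsTo (fun q : (Fin (n + 1) → ℝ) × (Fin (n + 1) → Fin n → ℝ) => q.2 k) K X :=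
    fun k q hq => hq.1.2 k (Set.mem_univ k)
  have husc : UpperSemicontinuousOn (fun q => ∑ k, q.1 k * f (q.2 k)) K :=
    upperSemicontinuousOn_sum fun k _ =>
      ContinuousOn.mul_upperSemicontinuousOn (by fun_prop)
        (hf.comp (by fun_prop) (hKX k)) fun q hq => hq.1.1.1 k
  have hne : K.Nonempty := by
    obtain ⟨lam, xs, h₀, h₁, hxs, hsum⟩ := exists_fin_convexCombination_of_mem_convexHull hx
    exact ⟨(lam, xs), ⟨⟨h₀, h₁⟩, fun k _ => hxs k⟩, hsum⟩
  obtain ⟨q, hq, hmax⟩ := husc.exists_isMaxOn hne hK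
  have hgreat : IsGreatest { s : ℝ | ∃ (lam : Fin (n + 1) → ℝ) (xs : Fin (n + 1) → Fin n → ℝ),
      (∀ k, 0 ≤ lam k) ∧ (∑ k, lam k = 1) ∧ (∀ k, xs k ∈ X) ∧
      (∑ k, lam k • xs k = x) ∧ s = ∑ k, lam k * f (xs k) } (∑ k, q.1 k * f (q.2 k)) := by
    refine ⟨⟨q.1, q.2, hq.1.1.1, hq.1.1.2, fun k => hKX k hq, hq.2, rfl⟩, ?_⟩
    rintro s ⟨lam, xs, h₀, h₁, hxs, hsum, rfl⟩
    exact hmax (show (lam, xs) ∈ K from ⟨⟨⟨h₀, h₁⟩, fun k _ => hxs k⟩, hsum⟩)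
  rw [concaveEnvelope, hgreat.csSup_eq]
  exact hgreat

theorem sum_mul_le_concaveEnvelope {n : ℕ} {X : Set (Fin n → ℝ)} (hX : IsCompact X)
    {f : (Fin n → ℝ) → ℝ} (hf : UpperSemicontinuousOn f X) {lam : Fin (n + 1) → ℝ}
    {xs : Fin (n + 1) → Fin n → ℝ} (hlam : lam ∈ stdSimplex ℝ (Fin (n + 1)))
    (hxs : ∀ k, xs k ∈ X) :
    ∑ k, lam k * f (xs k) ≤ concaveEnvelope X f (∑ k, lam k • xs k) :=
  (isGreatest_concaveEnvelope hX hf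
    (mem_convexHull_of_exists_fintype lam xs hlam.1 hlam.2 hxs rfl)).2
      ⟨lam, xs, hlam.1, hlam.2, hxs, rfl, rfl⟩

theorem exists_mem_stdSimplex_of_mem_convexHull_range {E ι : Type*} [AddCommGroup E] [Module ℝ E]
    [Fintype ι] {v : ι → E} {x : E} (hx : x ∈ convexHull ℝ (Set.range v)) :
    ∃ w ∈ stdSimplex ℝ ι, ∑ i, w i • v i = x := by
  classical
  have hsub : convexHull ℝ (Set.range v) ⊆ Fintype.linearCombination ℝ v '' stdSimplex ℝ ι := by
    refine convexHull_min ?_ ((convex_stdSimplex ℝ ι).linear_image _)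
    rintro _ ⟨i, rfl⟩
    exact ⟨Pi.single i 1, single_mem_stdSimplex ℝ i, by simp⟩
  obtain ⟨w, hw, rfl⟩ := hsub hx
  exact ⟨w, hw, by simp [Fintype.linearCombination_apply]⟩

/-- If all convex combinations of a finite family lie in `S`, an extreme point of `S` that is such
a combination is a member of the family. -/
theorem mem_range_of_mem_extremePoints {E ι : Type*} [AddCommGroup E] [Module ℝ E]
    [Fintype ι] {S : Set E} {v : ι → E} (hv : ∀ w ∈ stdSimplex ℝ ι, ∑ i, w i • v i ∈ S) {x : E}
    (hx : x ∈ S.extremePoints ℝ) {w : ι → ℝ} (hw : w ∈ stdSimplex ℝ ι)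
    (hwx : ∑ i, w i • v i = x) : x ∈ Set.range v := by
  refine extremePoints_convexHull_subset (𝕜 := ℝ) <|
    inter_extremePoints_subset_extremePoints_of_subset (A := S) ?_
      ⟨mem_convexHull_of_exists_fintype w v hw.1 hw.2 Set.mem_range_self hwx, hx⟩
  intro y hy
  obtain ⟨w', hw', rfl⟩ := exists_mem_stdSimplex_of_mem_convexHull_range hy
  exact hv w' hw'

theorem mulVec_sum_smul_add {n m p : ℕ} {ι : Type*} [Fintype ι] (A : Matrix (Fin p) (Fin n) ℝ)
    (B : Matrix (Fin p) (Fin m) ℝ) (d : Fin p → ℝ) {w : ι → ℝ} (hw : ∑ i, w i = 1)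
    (xs : ι → Fin n → ℝ) (ys : ι → Fin m → ℝ) :
    A.mulVec (∑ i, w i • xs i) + B.mulVec (∑ i, w i • ys i) + d =
      ∑ i, w i • (A.mulVec (xs i) + B.mulVec (ys i) + d) := by
  simp only [smul_add, Finset.sum_add_distrib, ← Finset.sum_smul, hw, one_smul,
    Matrix.mulVec_sum, Matrix.mulVec_smul]

theorem extremePoints_subset_of_fullColumnRank
    {n m p : ℕ} (X : Set (Fin n → ℝ)) (hXne : X.Nonempty) (hX : IsCompact X)
    (A : Matrix (Fin p) (Fin n) ℝ) (B : Matrix (Fin p) (Fin m) ℝ)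
    -- B has linearly independent columns, i.e. y ↦ By is injective
    (hB : Function.Injective B.mulVecLin) (d : Fin p → ℝ)
    (f : (Fin n → ℝ) → ℝ) (hf : UpperSemicontinuousOn f X)
    -- Assumption 1
    (hA1 : ∀ x ∈ X, ∃ y : Fin m → ℝ, euclNorm (A.mulVec x + B.mulVec y + d) ≤ f x)
    -- Assumption 2
    (hA2col : ∀ j : Fin n, (fun i => A i j) ∈ LinearMap.range B.mulVecLin)
    (hA2d : d ∈ LinearMap.range B.mulVecLin) :
    ∀ q ∈ Set.extremePoints ℝ {q : (Fin n → ℝ) × (Fin m → ℝ) | q.1 ∈ convexHull ℝ X ∧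
        euclNorm (A.mulVec q.1 + B.mulVec q.2 + d) ≤ concaveEnvelope X f q.1},
      q ∈ {q : (Fin n → ℝ) × (Fin m → ℝ) | q.1 ∈ X ∧
        euclNorm (A.mulVec q.1 + B.mulVec q.2 + d) ≤ f q.1} := by
  rintro ⟨x, y⟩ hq
  obtain ⟨hxX, hxy⟩ := hq.1
  dsimp only at hxX hxy
  have hf₀ : ∀ x ∈ X, 0 ≤ f x := fun x hx =>
    let ⟨_, hy⟩ := hA1 x hx
    (euclNorm_nonneg _).trans hy
  have hA2 : ∀ x, A.mulVec x + d ∈ LinearMap.range B.mulVecLin := by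
    intro x
    refine add_mem ?_ hA2d
    rw [Matrix.mulVec_eq_sum]
    refine Submodule.sum_mem _ fun j _ => ?_
    rw [op_smul_eq_smul]
    exact Submodule.smul_mem _ _ (hA2col j)
  obtain ⟨lam, xs, h₀, h₁, hxs, hsum, hval⟩ := (isGreatest_concaveEnvelope hX hf hxX).1
  set F := concaveEnvelope X f x
  set v := A.mulVec x + B.mulVec y + d
  have hF₀ : 0 ≤ F := (euclNorm_nonneg v).trans hxy
  have hy : ∀ k, ∃ yk : Fin m → ℝ, A.mulVec (xs k) + B.mulVec yk + d = (f (xs k) / F) • v := by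
    intro k
    have hv : v ∈ LinearMap.range B.mulVecLin := by
      rw [show v = (A.mulVec x + d) + B.mulVecLin y by simp [v, add_right_comm]]
      exact add_mem (hA2 x) ⟨y, rfl⟩
    obtain ⟨yk, hyk⟩ := sub_mem (Submodule.smul_mem _ (f (xs k) / F) hv) (hA2 (xs k))
    rw [Matrix.mulVecLin_apply] at hyk
    exact ⟨yk, by rw [hyk]; abel⟩
  choose ys hys using hy
  have hle : ∀ k, euclNorm (A.mulVec (xs k) + B.mulVec (ys k) + d) ≤ f (xs k) := by
    intro k
    rw [hys, euclNorm_smul (div_nonneg (hf₀ _ (hxs k)) hF₀), div_mul_eq_mul_div]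
    exact div_le_of_le_mul₀ hF₀ (hf₀ _ (hxs k))
      (mul_le_mul_of_nonneg_left hxy (hf₀ _ (hxs k)))
  have hysum : ∑ k, lam k • ys k = y := by
    apply hB
    have h := mulVec_sum_smul_add A B d h₁ xs ys
    have hv : ∑ k, lam k • (f (xs k) / F) • v = v := by
      simp only [smul_smul, ← Finset.sum_smul, mul_div_assoc', ← Finset.sum_div]
      rw [← hval]
      rcases hF₀.eq_or_lt with hF | hF
      · rw [eq_zero_of_euclNorm_nonpos (hxy.trans hF.ge), smul_zero]
      · rw [div_self hF.ne', one_smul]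
    simp only [hys, hv, hsum] at h
    exact add_left_cancel (add_right_cancel h)
  have hcomb : ∀ w ∈ stdSimplex ℝ (Fin (n + 1)), ∑ k, w k • (xs k, ys k) ∈
      {q : (Fin n → ℝ) × (Fin m → ℝ) | q.1 ∈ convexHull ℝ X ∧
        euclNorm (A.mulVec q.1 + B.mulVec q.2 + d) ≤ concaveEnvelope X f q.1} := by
    intro w hw
    simp only [Set.mem_ofPred_eq, Prod.fst_sum, Prod.snd_sum, Prod.smul_fst, Prod.smul_snd]
    refine ⟨mem_convexHull_of_exists_fintype w xs hw.1 hw.2 hxs rfl, ?_⟩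
    rw [mulVec_sum_smul_add A B d hw.2]
    exact (euclNorm_sum_smul_le hw.1 _).trans <|
      (Finset.sum_le_sum fun k _ => mul_le_mul_of_nonneg_left (hle k) (hw.1 k)).trans <|
        sum_mul_le_concaveEnvelope hX hf hw hxs
  have hqsum : ∑ k, lam k • (xs k, ys k) = (x, y) := by
    ext1
    · simpa only [Prod.fst_sum, Prod.smul_fst] using hsum
    · simpa only [Prod.snd_sum, Prod.smul_snd] using hysum
  obtain ⟨k, hk⟩ := mem_range_of_mem_extremePoints hcomb hq ⟨h₀, h₁⟩ hqsum
  rw [← hk]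
  exact ⟨hxs k, hle k⟩
end

section
/- Let X ⊆ ℝⁿ be a compact set, A a real p×n matrix, B a real p×m matrix with linearly independent columns (i.e., the linear map y ↦ By is injective), d ∈ ℝᵖ, and f : ℝⁿ → ℝ be upper semicontinuous on X. Then the set Z = { (x,y) ∈ X × ℝᵐ : ‖Ax + By + d‖₂ ≤ f(x) } is compact. -/
open Finset Matrix

theorem continuous_euclNorm {p : ℕ} : Continuous (euclNorm : (Fin p → ℝ) → ℝ) := by
  unfold euclNorm
  fun_prop

theorem norm_le_euclNorm {p : ℕ} (v : Fin p → ℝ) : ‖v‖ ≤ euclNorm v := by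
  refine (pi_norm_le_iff_of_nonneg (Real.sqrt_nonneg _)).2 fun i => Real.abs_le_sqrt ?_
  exact Finset.single_le_sum (f := fun i => v i ^ 2) (fun j _ => sq_nonneg (v j))
    (Finset.mem_univ i)

theorem isCompact_Z_of_fullColumnRank
    {n m p : ℕ} (X : Set (Fin n → ℝ)) (hX : IsCompact X)
    (A : Matrix (Fin p) (Fin n) ℝ) (B : Matrix (Fin p) (Fin m) ℝ)
    -- B has linearly independent columns, i.e. y ↦ By is injective
    (hB : Function.Injective B.mulVecLin) (d : Fin p → ℝ)
    (f : (Fin n → ℝ) → ℝ) (hf : UpperSemicontinuousOn f X) :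
    IsCompact {q : (Fin n → ℝ) × (Fin m → ℝ) | q.1 ∈ X ∧
      euclNorm (A.mulVec q.1 + B.mulVec q.2 + d) ≤ f q.1} := by
  obtain ⟨M, hM⟩ := hf.bddAbove_of_isCompact hX
  have hBc : Topology.IsClosedEmbedding B.mulVecLin :=
    LinearMap.isClosedEmbedding_of_injective (LinearMap.ker_eq_bot.2 hB)
  let T : (Fin n → ℝ) × (Fin p → ℝ) → (Fin p → ℝ) := fun r => r.2 - A.mulVec r.1 - d
  have hK : IsCompact (T '' (X ×ˢ Metric.closedBall 0 M)) :=
    (hX.prod (isCompact_closedBall 0 M)).image (by fun_prop)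
  refine (hX.prod (hBc.isCompact_preimage hK)).of_isClosed_subset ?_ ?_
  · have hc : Continuous fun q : (Fin n → ℝ) × (Fin m → ℝ) =>
        (q.1, euclNorm (A.mulVec q.1 + B.mulVec q.2 + d)) :=
      continuous_fst.prodMk (continuous_euclNorm.comp (by fun_prop))
    exact ((upperSemicontinuousOn_iff_isClosed_hypograph hX.isClosed).1 hf).preimage hc
  · rintro ⟨x, y⟩ ⟨hx, hxy⟩
    refine ⟨hx, (x, A.mulVec x + B.mulVec y + d), ⟨hx, ?_⟩, ?_⟩
    · exact mem_closedBall_zero_iff.2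
        ((norm_le_euclNorm _).trans (hxy.trans (hM ⟨x, hx, rfl⟩)))
    · simp only [T, Matrix.mulVecLin_apply]
      abel
end

section
/- Let X ⊆ ℝⁿ be a compact set, f : ℝⁿ → ℝ be upper semicontinuous on X, and let q : ℝⁿ → ℝ satisfy q(x) = f(x)² for all x ∈ X. Let f̂ and q̂ be the concave envelopes over conv(X) of f and q respectively. Suppose 0 ≤ L ≤ f(x) ≤ U for all x ∈ X, with L + U > 0. Then for all x ∈ conv(X), √(q̂(x)) − f̂(x) ≤ (U − L)² / (4(L + U)). -/
open Finset

theorem sqrt_secant_le {L U F : ℝ} (hLU : 0 < L + U) (hF : 0 ≤ F) :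
    Real.sqrt ((L + U) * F - L * U) ≤ F + (U - L) ^ 2 / (4 * (L + U)) := by
  refine Real.sqrt_le_iff.2 ⟨by positivity, ?_⟩
  have h : (F + (U - L) ^ 2 / (4 * (L + U))) ^ 2 - ((L + U) * F - L * U)
      = (F + (U - L) ^ 2 / (4 * (L + U)) - (L + U) / 2) ^ 2 := by
    field_simp
    ring
  nlinarith [sq_nonneg (F + (U - L) ^ 2 / (4 * (L + U)) - (L + U) / 2)]

theorem le_concaveEnvelope {n : ℕ} {X : Set (Fin n → ℝ)} {f : (Fin n → ℝ) → ℝ} {U : ℝ}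
    (hU : ∀ x ∈ X, f x ≤ U) {lam : Fin (n + 1) → ℝ} {xs : Fin (n + 1) → Fin n → ℝ}
    (hlam : ∀ k, 0 ≤ lam k) (hsum : ∑ k, lam k = 1) (hxs : ∀ k, xs k ∈ X) :
    ∑ k, lam k * f (xs k) ≤ concaveEnvelope X f (∑ k, lam k • xs k) := by
  refine le_csSup ⟨U, ?_⟩ ⟨lam, xs, hlam, hsum, hxs, rfl, rfl⟩
  rintro s ⟨mu, ys, hmu, hmusum, hys, -, rfl⟩
  calc ∑ k, mu k * f (ys k) ≤ ∑ k, mu k * U :=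
        Finset.sum_le_sum fun k _ => mul_le_mul_of_nonneg_left (hU _ (hys k)) (hmu k)
    _ = U := by rw [← Finset.sum_mul, hmusum, one_mul]

theorem concaveEnvelope_nonneg {n : ℕ} {X : Set (Fin n → ℝ)} {f : (Fin n → ℝ) → ℝ}
    (hf : ∀ x ∈ X, 0 ≤ f x) (x : Fin n → ℝ) : 0 ≤ concaveEnvelope X f x := by
  refine Real.sSup_nonneg ?_
  rintro s ⟨lam, xs, hlam, -, hxs, -, rfl⟩
  exact Finset.sum_nonneg fun k _ => mul_nonneg (hlam k) (hf _ (hxs k))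

theorem sqrt_envelope_gap_bound
    {n : ℕ} (X : Set (Fin n → ℝ)) (hX : IsCompact X)
    (f : (Fin n → ℝ) → ℝ) (hf : UpperSemicontinuousOn f X)
    (q : (Fin n → ℝ) → ℝ) (hq : ∀ x ∈ X, q x = f x ^ 2)
    (L U : ℝ) (hL : 0 ≤ L) (hbounds : ∀ x ∈ X, L ≤ f x ∧ f x ≤ U)
    (hLU : 0 < L + U) :
    ∀ x ∈ convexHull ℝ X,
      Real.sqrt (concaveEnvelope X q x) - concaveEnvelope X f x
        ≤ (U - L) ^ 2 / (4 * (L + U)) := by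
  intro x _
  have hF : 0 ≤ concaveEnvelope X f x :=
    concaveEnvelope_nonneg (fun y hy => hL.trans (hbounds y hy).1) x
  have hbound := sqrt_secant_le hLU hF
  by_cases hq0 : concaveEnvelope X q x ≤ 0
  · rw [Real.sqrt_eq_zero_of_nonpos hq0]
    have : 0 ≤ (U - L) ^ 2 / (4 * (L + U)) := by positivity
    linarith
  have hle : concaveEnvelope X q x ≤ (L + U) * concaveEnvelope X f x - L * U := by
    refine csSup_le ?_ ?_
    · by_contra hne
      refine hq0 (le_of_eq ?_)
      rw [concaveEnvelope, Set.not_nonempty_iff_eq_empty.1 hne, Real.sSup_empty]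
    · rintro s ⟨lam, xs, hlam, hsum, hxs, rfl, rfl⟩
      calc ∑ k, lam k * q (xs k)
          ≤ ∑ k, ((L + U) * (lam k * f (xs k)) - lam k * (L * U)) := by
            refine Finset.sum_le_sum fun k _ => ?_
            obtain ⟨h1, h2⟩ := hbounds _ (hxs k)
            rw [hq _ (hxs k)]
            nlinarith [mul_nonneg (hlam k) (mul_nonneg (sub_nonneg.2 h1) (sub_nonneg.2 h2))]
        _ = (L + U) * ∑ k, lam k * f (xs k) - L * U := by
            rw [Finset.sum_sub_distrib, ← Finset.mul_sum, ← Finset.sum_mul, hsum, one_mul]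
        _ ≤ _ := by
            gcongr
            exact le_concaveEnvelope (fun y hy => (hbounds y hy).2) hlam hsum hxs
  linarith [Real.sqrt_le_sqrt hle]
end
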